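/- arXiv:2306.11951 — 3 statements merged into one kernel-verified Lean document; each statement's English description precedes it below -/
import Mathlib

section
/- For every K ≥ 2, p ∈ (0,1/2) and T ≥ 0, any non-adaptive T-round algorithm for identifying the maximum among K items from noisy pairwise comparisons satisfies sup over instances θ (assignments of K distinct real values) of P(μ̂ ≠ MAX(θ)) ≥ (1/4)·exp(−2T·D_KL(p‖1−p)/(K(K−1))). Consequently, any such algorithm whose worst-case error probability is at most δ < 1/4 must use T ≥ (K(K−1)/2)·ln(1/(4δ))/D_KL(p‖1−p) queries. -/
/-- KL divergence (in nats) between `Bernoulli(p)` and `Bernoulli(1-p)`: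
`D_KL(p‖1-p) = (1-2p) ln((1-p)/p)`. -/
noncomputable def klBer (p : ℝ) : ℝ := (1 - 2 * p) * Real.log ((1 - p) / p)

open Classical in
/-- Error probability of a non-adaptive `T`-round strategy for identifying the
maximum of `K` items with values `θ : Fin K → ℝ` from noisy pairwise comparisons.
The strategy fixes in advance a sequence of distributions `π t` over ordered pairs;
at round `t` the queried pair `ks t` is drawn from `π t` independently of everything
else, and the indicator of `θ (ks t).1 > θ (ks t).2` flipped independently with
probability `p` is observed.  The output rule `out` sees the queried pairs and the
observations, and the algorithm errs unless its output is the index of the largest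
value. -/
noncomputable def naErrMAX (K T : ℕ) (p : ℝ)
    (π : Fin T → Fin K × Fin K → ℝ)
    (out : (Fin T → Fin K × Fin K) → (Fin T → Bool) → Fin K) (θ : Fin K → ℝ) : ℝ :=
  ∑ ks : Fin T → Fin K × Fin K, ∑ ys : Fin T → Bool,
    (∏ t : Fin T,
        π t (ks t) * (if ys t = decide (θ (ks t).1 > θ (ks t).2) then 1 - p else p)) *
      (if ∀ j, j ≠ out ks ys → θ j < θ (out ks ys) then 0 else 1)

open Finset in
/-- A form of the Bretagnolle–Huber inequality: two tests whose errors cover the whole space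
have total error at least half the squared Bhattacharyya coefficient. -/
lemma half_sq_bhattacharyya_le {α : Type*} [Fintype α] (P Q f g : α → ℝ)
    (hP : ∀ a, 0 ≤ P a) (hQ : ∀ a, 0 ≤ Q a) (hP1 : ∑ a, P a = 1) (hQ1 : ∑ a, Q a = 1)
    (hf : ∀ a, 0 ≤ f a) (hg : ∀ a, 0 ≤ g a) (hfg : ∀ a, 1 ≤ f a + g a) :
    (∑ a, √(P a * Q a)) ^ 2 / 2 ≤ ∑ a, P a * f a + ∑ a, Q a * g a := by
  have hmin : ∑ a, min (P a) (Q a) ≤ ∑ a, P a * f a + ∑ a, Q a * g a := by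
    rw [← sum_add_distrib]
    refine sum_le_sum fun a _ => ?_
    have h0 : 0 ≤ min (P a) (Q a) := le_min (hP a) (hQ a)
    nlinarith [mul_le_mul_of_nonneg_right (min_le_left (P a) (Q a)) (hf a),
      mul_le_mul_of_nonneg_right (min_le_right (P a) (Q a)) (hg a),
      mul_le_mul_of_nonneg_left (hfg a) h0]
  have hmax : ∑ a, max (P a) (Q a) ≤ 2 := by
    calc ∑ a, max (P a) (Q a) ≤ ∑ a, (P a + Q a) :=
          sum_le_sum fun a _ => max_le (by linarith [hQ a]) (by linarith [hP a])
      _ = 2 := by rw [sum_add_distrib, hP1, hQ1]; norm_num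
  have hcs : (∑ a, √(P a * Q a)) ^ 2 ≤ (∑ a, min (P a) (Q a)) * ∑ a, max (P a) (Q a) := by
    refine sum_sq_le_sum_mul_sum_of_sq_le_mul _ (fun a _ => le_min (hP a) (hQ a))
      (fun a _ => le_max_of_le_left (hP a)) fun a _ => ?_
    rw [Real.sq_sqrt (mul_nonneg (hP a) (hQ a)), min_mul_max]
  have h0 : 0 ≤ ∑ a, min (P a) (Q a) := sum_nonneg fun a _ => le_min (hP a) (hQ a)
  nlinarith [mul_le_mul_of_nonneg_left hmax h0]

lemma sum_sum_prod_eq_prod_sum_sum {T : ℕ} {A B : Type*} [Fintype A] [Fintype B]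
    (F : Fin T → A → B → ℝ) :
    ∑ ks : Fin T → A, ∑ ys : Fin T → B, ∏ t, F t (ks t) (ys t) = ∏ t, ∑ a, ∑ b, F t a b := by
  classical
  simp_rw [← Fintype.sum_prod_type']
  rw [Finset.prod_univ_sum, Fintype.piFinset_univ]
  exact (Fintype.sum_equiv (Equiv.arrowProdEquivProdArrow (Fin T) (fun _ => A) (fun _ => B))
    _ _ fun _ => rfl).symm

/-- The probability of observing `y` when the noiseless answer is `b`. -/
noncomputable def noisyBit (p : ℝ) (b y : Bool) : ℝ := if y = b then 1 - p else p

lemma noisyBit_nonneg {p : ℝ} (hp0 : 0 < p) (hp1 : p < 1 / 2) (b y : Bool) :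
    0 ≤ noisyBit p b y := by
  unfold noisyBit; split_ifs <;> linarith

lemma sum_noisyBit (p : ℝ) (b : Bool) : ∑ y, noisyBit p b y = 1 := by
  cases b <;> simp [noisyBit]

lemma exp_neg_half_klBer_le {p : ℝ} (hp0 : 0 < p) (hp1 : p < 1 / 2) :
    Real.exp (-(klBer p / 2)) ≤ 2 * √(p * (1 - p)) := by
  have hq : 0 < 1 - p := by linarith
  set L := Real.log ((1 - p) / p) with hL
  have hLe : Real.exp L = (1 - p) / p := Real.exp_log (by positivity)
  have h1 : √(p * (1 - p)) = p * Real.exp (L / 2) := by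
    rw [Real.sqrt_eq_iff_mul_self_eq (by positivity) (by positivity)]
    have : Real.exp (L / 2) * Real.exp (L / 2) = (1 - p) / p := by
      rw [← Real.exp_add, add_halves, hLe]
    symm
    calc p * Real.exp (L / 2) * (p * Real.exp (L / 2))
        = p * p * (Real.exp (L / 2) * Real.exp (L / 2)) := by ring
      _ = p * (1 - p) := by rw [this]; field_simp
  have h2 : √(p * (1 - p)) = (1 - p) * Real.exp (-(L / 2)) := by
    rw [h1, Real.exp_neg]
    have : Real.exp (L / 2) * Real.exp (L / 2) = (1 - p) / p := by
      rw [← Real.exp_add, add_halves, hLe]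
    field_simp at this ⊢
    linarith
  have h3 := convexOn_exp.2 (Set.mem_univ (L / 2)) (Set.mem_univ (-(L / 2))) hp0.le hq.le
    (by ring)
  simp only [smul_eq_mul] at h3
  calc Real.exp (-(klBer p / 2)) = Real.exp (p * (L / 2) + (1 - p) * -(L / 2)) := by
        congr 1; rw [klBer]; ring
    _ ≤ _ := h3
    _ = _ := by rw [← h1, ← h2]; ring

lemma sum_sqrt_noisyBit_self {p : ℝ} (hp0 : 0 < p) (hp1 : p < 1 / 2) (b : Bool) :
    ∑ y, √(noisyBit p b y * noisyBit p b y) = 1 := by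
  simp_rw [Real.sqrt_mul_self (noisyBit_nonneg hp0 hp1 b _), sum_noisyBit]

lemma klBer_pos {p : ℝ} (hp0 : 0 < p) (hp1 : p < 1 / 2) : 0 < klBer p := by
  refine mul_pos (by linarith) (Real.log_pos ?_)
  rw [lt_div_iff₀ hp0]; linarith

lemma exp_neg_half_klBer_le_sum_sqrt {p : ℝ} (hp0 : 0 < p) (hp1 : p < 1 / 2) (b c : Bool) :
    Real.exp (-(klBer p / 2)) ≤ ∑ y, √(noisyBit p b y * noisyBit p c y) := by
  by_cases h : b = c
  · subst h
    rw [sum_sqrt_noisyBit_self hp0 hp1, Real.exp_le_one_iff]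
    linarith [klBer_pos hp0 hp1]
  · refine (exp_neg_half_klBer_le hp0 hp1).trans (le_of_eq ?_)
    cases b <;> cases c <;> simp_all [noisyBit, mul_comm, two_mul]

open Classical in
/-- The law of the queried pairs and observations on the instance `θ`. -/
noncomputable def transcriptLaw {K T : ℕ} (p : ℝ) (π : Fin T → Fin K × Fin K → ℝ)
    (θ : Fin K → ℝ) (x : (Fin T → Fin K × Fin K) × (Fin T → Bool)) : ℝ :=
  ∏ t, π t (x.1 t) * noisyBit p (decide (θ (x.1 t).1 > θ (x.1 t).2)) (x.2 t)

open Classical in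
/-- The indicator that `m` is not the index of the largest value of `θ`. -/
noncomputable def notMaxIndicator {K : ℕ} (θ : Fin K → ℝ) (m : Fin K) : ℝ :=
  if ∀ j, j ≠ m → θ j < θ m then 0 else 1

lemma notMaxIndicator_nonneg {K : ℕ} (θ : Fin K → ℝ) (m : Fin K) :
    0 ≤ notMaxIndicator θ m := by
  unfold notMaxIndicator; split_ifs <;> norm_num

lemma notMaxIndicator_le_one {K : ℕ} (θ : Fin K → ℝ) (m : Fin K) :
    notMaxIndicator θ m ≤ 1 := by
  unfold notMaxIndicator; split_ifs <;> norm_num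

lemma notMaxIndicator_eq_one {K : ℕ} {θ : Fin K → ℝ} {m i : Fin K} (hi : i ≠ m)
    (h : θ m ≤ θ i) : notMaxIndicator θ m = 1 :=
  if_neg fun hm => (hm i hi).not_ge h

lemma naErrMAX_eq_sum_transcriptLaw {K T : ℕ} (p : ℝ) (π : Fin T → Fin K × Fin K → ℝ)
    (out : (Fin T → Fin K × Fin K) → (Fin T → Bool) → Fin K) (θ : Fin K → ℝ) :
    naErrMAX K T p π out θ =
      ∑ x, transcriptLaw p π θ x * notMaxIndicator θ (out x.1 x.2) := by
  rw [Fintype.sum_prod_type]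
  rfl

section

variable {K T : ℕ} {p : ℝ} {π : Fin T → Fin K × Fin K → ℝ}

lemma transcriptLaw_nonneg (hp0 : 0 < p) (hp1 : p < 1 / 2) (hπ0 : ∀ t k, 0 ≤ π t k)
    (θ : Fin K → ℝ) (x) : 0 ≤ transcriptLaw p π θ x :=
  Finset.prod_nonneg fun t _ => mul_nonneg (hπ0 t _) (noisyBit_nonneg hp0 hp1 _ _)

lemma sum_transcriptLaw (hπ1 : ∀ t, ∑ k, π t k = 1) (θ : Fin K → ℝ) :
    ∑ x, transcriptLaw p π θ x = 1 := by
  rw [Fintype.sum_prod_type]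
  unfold transcriptLaw
  rw [sum_sum_prod_eq_prod_sum_sum
    (fun t k y => π t k * noisyBit p (decide (θ k.1 > θ k.2)) y)]
  simp_rw [← Finset.mul_sum, sum_noisyBit, mul_one, hπ1, Finset.prod_const_one]

lemma naErrMAX_le_one (hp0 : 0 < p) (hp1 : p < 1 / 2) (hπ0 : ∀ t k, 0 ≤ π t k)
    (hπ1 : ∀ t, ∑ k, π t k = 1)
    (out : (Fin T → Fin K × Fin K) → (Fin T → Bool) → Fin K) (θ : Fin K → ℝ) :
    naErrMAX K T p π out θ ≤ 1 := by
  rw [naErrMAX_eq_sum_transcriptLaw, ← sum_transcriptLaw (p := p) hπ1 θ]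
  exact Finset.sum_le_sum fun x _ =>
    mul_le_of_le_one_right (transcriptLaw_nonneg hp0 hp1 hπ0 θ x) (notMaxIndicator_le_one _ _)

/-- If the comparisons under `θ` and `θ'` agree outside the set `S` of pairs, then the
Bhattacharyya coefficient of the transcripts is controlled by the mass the queries put on `S`. -/
lemma exp_le_sum_sqrt_transcriptLaw (hp0 : 0 < p) (hp1 : p < 1 / 2)
    (hπ0 : ∀ t k, 0 ≤ π t k) (hπ1 : ∀ t, ∑ k, π t k = 1) (θ θ' : Fin K → ℝ)
    (S : Finset (Fin K × Fin K)) (hS : ∀ k ∉ S, (θ k.1 > θ k.2 ↔ θ' k.1 > θ' k.2)) :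
    Real.exp (-(klBer p / 2 * ∑ t, ∑ k ∈ S, π t k)) ≤
      ∑ x, √(transcriptLaw p π θ x * transcriptLaw p π θ' x) := by
  classical
  have hsq : ∀ x : (Fin T → Fin K × Fin K) × (Fin T → Bool),
      √(transcriptLaw p π θ x * transcriptLaw p π θ' x) =
      ∏ t, π t (x.1 t) * √(noisyBit p (decide (θ (x.1 t).1 > θ (x.1 t).2)) (x.2 t) *
        noisyBit p (decide (θ' (x.1 t).1 > θ' (x.1 t).2)) (x.2 t)) := by
    intro x
    have hn : ∀ t, 0 ≤ noisyBit p (decide (θ (x.1 t).1 > θ (x.1 t).2)) (x.2 t) *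
        noisyBit p (decide (θ' (x.1 t).1 > θ' (x.1 t).2)) (x.2 t) := fun t =>
      mul_nonneg (noisyBit_nonneg hp0 hp1 _ _) (noisyBit_nonneg hp0 hp1 _ _)
    rw [Real.sqrt_eq_iff_mul_self_eq
      (mul_nonneg (transcriptLaw_nonneg hp0 hp1 hπ0 θ x) (transcriptLaw_nonneg hp0 hp1 hπ0 θ' x))
      (Finset.prod_nonneg fun t _ => mul_nonneg (hπ0 t _) (Real.sqrt_nonneg _))]
    unfold transcriptLaw
    rw [← Finset.prod_mul_distrib, ← Finset.prod_mul_distrib]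
    refine Finset.prod_congr rfl fun t _ => ?_
    rw [mul_mul_mul_comm, mul_mul_mul_comm (π t (x.1 t)) (√_), Real.mul_self_sqrt (hn t)]
  simp_rw [hsq]
  rw [Fintype.sum_prod_type, sum_sum_prod_eq_prod_sum_sum
    (fun t k y => π t k * √(noisyBit p (decide (θ k.1 > θ k.2)) y *
      noisyBit p (decide (θ' k.1 > θ' k.2)) y)), Finset.mul_sum, ← Finset.sum_neg_distrib,
    Real.exp_sum]
  refine Finset.prod_le_prod (fun _ _ => (Real.exp_pos _).le) fun t _ => ?_
  have hJ := convexOn_exp.map_sum_le (t := Finset.univ) (w := π t)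
    (p := fun k => if k ∈ S then -(klBer p / 2) else 0) (fun k _ => hπ0 t k) (hπ1 t)
    (fun _ _ => Set.mem_univ _)
  simp only [smul_eq_mul, mul_ite, mul_zero, Finset.sum_ite_mem, Finset.univ_inter] at hJ
  rw [← Finset.sum_mul] at hJ
  calc _ = Real.exp ((∑ k ∈ S, π t k) * -(klBer p / 2)) := by congr 1; ring
    _ ≤ _ := hJ
    _ ≤ _ := by
      refine Finset.sum_le_sum fun k _ => ?_
      rw [← Finset.mul_sum]
      refine mul_le_mul_of_nonneg_left ?_ (hπ0 t k)
      split_ifs with hk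
      · exact exp_neg_half_klBer_le_sum_sqrt hp0 hp1 _ _
      · simp_rw [hS k hk, sum_sqrt_noisyBit_self hp0 hp1, Real.exp_zero, le_refl]

/-- Some pair of items is queried no more often than average. -/
lemma exists_rarely_queried_pair (hK : 2 ≤ K) (hπ0 : ∀ t k, 0 ≤ π t k)
    (hπ1 : ∀ t, ∑ k, π t k = 1) :
    ∃ i j : Fin K, i ≠ j ∧
      ∑ t, ∑ k ∈ {(i, j), (j, i)}, π t k ≤ 2 * (T : ℝ) / ((K : ℝ) * ((K : ℝ) - 1)) := by
  have hK' : (2 : ℝ) ≤ K := by exact_mod_cast hK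
  have hne : (Finset.univ : Finset (Fin K)).offDiag.Nonempty :=
    ⟨(⟨0, by omega⟩, ⟨1, by omega⟩), by simp⟩
  have hoff : ∀ t, ∑ k ∈ (Finset.univ : Finset (Fin K)).offDiag, π t k ≤ 1 := fun t =>
    (Finset.sum_le_univ_sum_of_nonneg (hπ0 t)).trans (hπ1 t).le
  have hswap : ∀ t, ∑ k ∈ (Finset.univ : Finset (Fin K)).offDiag, π t k.swap =
      ∑ k ∈ (Finset.univ : Finset (Fin K)).offDiag, π t k := fun t =>
    Finset.sum_equiv (Equiv.prodComm _ _) (by simp [eq_comm]) (by simp)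
  have hle : ∑ k ∈ (Finset.univ : Finset (Fin K)).offDiag, ∑ t, (π t k + π t k.swap) ≤
      ∑ _k ∈ (Finset.univ : Finset (Fin K)).offDiag,
        2 * (T : ℝ) / ((K : ℝ) * ((K : ℝ) - 1)) := by
    rw [Finset.sum_comm, Finset.sum_const, Finset.offDiag_card, nsmul_eq_mul,
      Finset.card_univ, Fintype.card_fin, Nat.cast_sub (Nat.le_mul_self K), Nat.cast_mul]
    calc ∑ t, ∑ k ∈ (Finset.univ : Finset (Fin K)).offDiag, (π t k + π t k.swap)
        ≤ ∑ _t : Fin T, (2 : ℝ) := by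
          refine Finset.sum_le_sum fun t _ => ?_
          rw [Finset.sum_add_distrib, hswap]
          linarith [hoff t]
      _ = 2 * T := by simp [mul_comm]
      _ = _ := by
        have h1 : (K : ℝ) ≠ 0 := by linarith
        have h2 : (K : ℝ) - 1 ≠ 0 := by linarith
        have h3 : (K : ℝ) * K - K = K * (K - 1) := by ring
        rw [h3]
        field_simp
  obtain ⟨⟨i, j⟩, hij, h⟩ := Finset.exists_le_of_sum_le hne hle
  have hij : i ≠ j := by simpa using hij
  refine ⟨i, j, hij, le_of_eq_of_le (Finset.sum_congr rfl fun t _ => ?_) h⟩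
  exact Finset.sum_pair (by simp [hij])

end

/-- An instance whose largest item is `i` and whose second largest is `j`. -/
def topTwo {K : ℕ} (i j : Fin K) (x : Fin K) : ℝ :=
  if x = i then K + 1 else if x = j then K else (x : ℕ)

lemma topTwo_injective {K : ℕ} (i j : Fin K) : Function.Injective (topTwo i j) := by
  intro x y h
  have hx : ((x : ℕ) : ℝ) < K := by exact_mod_cast x.2
  have hy : ((y : ℕ) : ℝ) < K := by exact_mod_cast y.2
  unfold topTwo at h
  split_ifs at h <;> first | (subst_vars; rfl) | linarith | exact Fin.ext (by exact_mod_cast h)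

lemma topTwo_le {K : ℕ} (i j x : Fin K) : topTwo i j x ≤ topTwo i j i := by
  have hx : ((x : ℕ) : ℝ) < K := by exact_mod_cast x.2
  unfold topTwo
  split_ifs <;> first | linarith | contradiction

lemma topTwo_gt_iff_swap {K : ℕ} {i j : Fin K} (hij : i ≠ j) (k : Fin K × Fin K)
    (hk : k ∉ ({(i, j), (j, i)} : Finset (Fin K × Fin K))) :
    topTwo i j k.1 > topTwo i j k.2 ↔ topTwo j i k.1 > topTwo j i k.2 := by
  obtain ⟨x, y⟩ := k
  have hx : ((x : ℕ) : ℝ) < K := by exact_mod_cast x.2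
  have hy : ((y : ℕ) : ℝ) < K := by exact_mod_cast y.2
  simp only [Finset.mem_insert, Finset.mem_singleton, Prod.mk.injEq, not_or, not_and] at hk
  unfold topTwo
  dsimp only
  split_ifs <;> grind

lemma exists_injective_le_error (K T : ℕ) (hK : 2 ≤ K) (p : ℝ) (hp0 : 0 < p) (hp1 : p < 1 / 2)
    (π : Fin T → Fin K × Fin K → ℝ) (hπ0 : ∀ t k, 0 ≤ π t k) (hπ1 : ∀ t, ∑ k, π t k = 1)
    (Ω : Type) [Fintype Ω] (w : Ω → ℝ) (hw0 : ∀ ω, 0 ≤ w ω) (hw1 : ∑ ω, w ω = 1)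
    (out : Ω → (Fin T → Fin K × Fin K) → (Fin T → Bool) → Fin K) :
    ∃ θ : Fin K → ℝ, Function.Injective θ ∧ (1 / 4 : ℝ) *
        Real.exp (-(2 * (T : ℝ) * klBer p) / ((K : ℝ) * ((K : ℝ) - 1))) ≤
          ∑ ω, w ω * naErrMAX K T p π (out ω) θ := by
  obtain ⟨i, j, hij, hq⟩ := exists_rarely_queried_pair hK hπ0 hπ1
  set q := ∑ t, ∑ k ∈ {(i, j), (j, i)}, π t k
  have hD := klBer_pos hp0 hp1
  set E := Real.exp (-(2 * (T : ℝ) * klBer p) / ((K : ℝ) * ((K : ℝ) - 1)))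
  have hE : E ≤ (Real.exp (-(klBer p / 2 * q))) ^ 2 := by
    rw [← Real.exp_nat_mul, Real.exp_le_exp]
    have := mul_le_mul_of_nonneg_left hq hD.le
    calc _ = -(klBer p * (2 * (T : ℝ) / ((K : ℝ) * ((K : ℝ) - 1)))) := by ring
      _ ≤ -(klBer p * q) := neg_le_neg this
      _ = _ := by push_cast; ring
  have key : ∀ ω, E / 2 ≤ naErrMAX K T p π (out ω) (topTwo i j) +
      naErrMAX K T p π (out ω) (topTwo j i) := by
    intro ω
    rw [naErrMAX_eq_sum_transcriptLaw, naErrMAX_eq_sum_transcriptLaw]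
    refine le_trans ?_ (half_sq_bhattacharyya_le _ _ _ _
      (transcriptLaw_nonneg hp0 hp1 hπ0 _) (transcriptLaw_nonneg hp0 hp1 hπ0 _)
      (sum_transcriptLaw hπ1 _) (sum_transcriptLaw hπ1 _)
      (fun _ => notMaxIndicator_nonneg _ _) (fun _ => notMaxIndicator_nonneg _ _) fun x => ?_)
    · have := pow_le_pow_left₀ (Real.exp_pos _).le (exp_le_sum_sqrt_transcriptLaw hp0 hp1 hπ0 hπ1
        (topTwo i j) (topTwo j i) _ (topTwo_gt_iff_swap hij)) 2
      linarith
    · by_cases hi : i = out ω x.1 x.2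
      · have hj : j ≠ out ω x.1 x.2 := fun h => hij (hi.trans h.symm)
        rw [notMaxIndicator_eq_one hj (topTwo_le _ _ _)]
        linarith [notMaxIndicator_nonneg (topTwo i j) (out ω x.1 x.2)]
      · rw [notMaxIndicator_eq_one hi (topTwo_le _ _ _)]
        linarith [notMaxIndicator_nonneg (topTwo j i) (out ω x.1 x.2)]
  have hsum : E / 2 ≤ ∑ ω, w ω * naErrMAX K T p π (out ω) (topTwo i j) +
      ∑ ω, w ω * naErrMAX K T p π (out ω) (topTwo j i) := by
    rw [← Finset.sum_add_distrib]
    calc E / 2 = ∑ ω, w ω * (E / 2) := by rw [← Finset.sum_mul, hw1, one_mul]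
      _ ≤ _ := Finset.sum_le_sum fun ω _ => by
        rw [← mul_add]
        exact mul_le_mul_of_nonneg_left (key ω) (hw0 ω)
  by_cases h : 1 / 4 * E ≤ ∑ ω, w ω * naErrMAX K T p π (out ω) (topTwo i j)
  · exact ⟨_, topTwo_injective i j, h⟩
  · exact ⟨_, topTwo_injective j i, by linarith⟩

/-- Lower bound for non-adaptively identifying the maximum of `K` items from noisy
pairwise comparisons.  Any (possibly randomized, via a seed `ω` for the output rule)
non-adaptive `T`-round algorithm has worst-case error probability, over instances `θ`
with `K` distinct real values, at least `(1/4)·exp(-2T·D_KL(p‖1-p)/(K(K-1)))`;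
consequently, if its worst-case error probability is at most `δ < 1/4` then
`T ≥ (K(K-1)/2)·ln(1/(4δ))/D_KL(p‖1-p)`. -/
theorem max_nonadaptive_lower_bound
    (K T : ℕ) (hK : 2 ≤ K) (p : ℝ) (hp0 : 0 < p) (hp1 : p < 1 / 2)
    (π : Fin T → Fin K × Fin K → ℝ) (hπ0 : ∀ t k, 0 ≤ π t k) (hπ1 : ∀ t, ∑ k, π t k = 1)
    (Ω : Type) [Fintype Ω] (w : Ω → ℝ) (hw0 : ∀ ω, 0 ≤ w ω) (hw1 : ∑ ω, w ω = 1)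
    (out : Ω → (Fin T → Fin K × Fin K) → (Fin T → Bool) → Fin K) :
    (1 / 4 : ℝ) *
        Real.exp (-(2 * (T : ℝ) * klBer p) / ((K : ℝ) * ((K : ℝ) - 1))) ≤
        (⨆ θ : {f : Fin K → ℝ // Function.Injective f},
          ∑ ω, w ω * naErrMAX K T p π (out ω) θ.1) ∧
      ∀ δ : ℝ, 0 < δ → δ < 1 / 4 →
        (∀ θ : Fin K → ℝ, Function.Injective θ →
          ∑ ω, w ω * naErrMAX K T p π (out ω) θ ≤ δ) →
        ((K : ℝ) * ((K : ℝ) - 1) / 2) * Real.log (1 / (4 * δ)) / klBer p ≤ (T : ℝ) := by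
  obtain ⟨θ, hθ, hle⟩ := exists_injective_le_error K T hK p hp0 hp1 π hπ0 hπ1 Ω w hw0 hw1 out
  refine ⟨le_ciSup_of_le ⟨1, ?_⟩ ⟨θ, hθ⟩ hle, fun δ hδ0 _ hδ => ?_⟩
  · rintro _ ⟨θ', rfl⟩
    dsimp only
    rw [← hw1]
    exact Finset.sum_le_sum fun ω _ =>
      mul_le_of_le_one_right (hw0 ω) (naErrMAX_le_one hp0 hp1 hπ0 hπ1 _ _)
  · have hK' : (2 : ℝ) ≤ K := by exact_mod_cast hK
    have hKK : 0 < (K : ℝ) * ((K : ℝ) - 1) := mul_pos (by linarith) (by linarith)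
    have hexp := (Real.le_log_iff_exp_le (by positivity)).2
      (show _ ≤ 4 * δ by linarith [hle.trans (hδ θ hθ)])
    rw [div_le_iff₀ hKK] at hexp
    rw [div_le_iff₀ (klBer_pos hp0 hp1), one_div, Real.log_inv]
    linarith
end

section
/- For every K ≥ 2, p ∈ (0,1/2) and T ≥ 0, any adaptive T-round algorithm for the noisy search problem satisfies sup over instances X of P(μ̂ ≠ SEARCH(X)) ≥ (1/4)·max( exp(−T·D_KL(p‖1−p)), 1 − T·(1−H(p))/log₂(K) ). -/
/-- Binary entropy (in bits): `H(p) = -p log₂ p - (1-p) log₂ (1-p)`. -/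
noncomputable def binEnt (p : ℝ) : ℝ :=
  -(p * Real.logb 2 p) - (1 - p) * Real.logb 2 (1 - p)

open Classical in
/-- `SEARCH(x)` for sorted values `Xs 0 < Xs 1 < ⋯ < Xs (K-1)`: the number of values
below the target `x`, i.e. the index `i ∈ {0,…,K}` with `X_i < x < X_{i+1}`
(where `X_0 = -∞`, `X_{K+1} = +∞`). -/
noncomputable def searchIdx {K : ℕ} (Xs : Fin K → ℝ) (x : ℝ) : ℕ :=
  (Finset.univ.filter fun i : Fin K => Xs i < x).card

/-- Error probability of a deterministic adaptive `T`-round strategy for the noisy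
search problem with known sorted values `Xs` and target `x`.  At round `t` the
strategy compares `x` with `Xs (q t ys)` (the query depending only on the
observations `ys s` for `s < t`, enforced by a separate hypothesis), and observes the
indicator of `x > Xs (q t ys)` flipped independently with probability `p`.  The
algorithm errs on an observation sequence `ys` unless its output equals
`SEARCH(x)`. -/
noncomputable def detErrSEARCH (K T : ℕ) (p : ℝ)
    (q : Fin T → (Fin T → Bool) → Fin K)
    (out : (Fin T → Bool) → ℕ) (Xs : Fin K → ℝ) (x : ℝ) : ℝ :=
  ∑ ys : Fin T → Bool,
    (∏ t : Fin T, if ys t = decide (x > Xs (q t ys)) then 1 - p else p) *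
      (if out ys = searchIdx Xs x then 0 else 1)

/-- Law of the indicator that one observation is correct. -/
noncomputable def correctWeight (p : ℝ) (b : Bool) : ℝ := if b = true then 1 - p else p

lemma correctWeight_pos {p : ℝ} (hp0 : 0 < p) (hp1 : p < 1 / 2) (b : Bool) :
    0 < correctWeight p b := by
  unfold correctWeight; split_ifs <;> linarith

lemma sum_correctWeight (p : ℝ) : ∑ b, correctWeight p b = 1 := by
  simp [correctWeight]

/-- `a t ys` depends only on the observations strictly before round `t`. -/
def IsPredictable {T : ℕ} {α : Type*} (a : Fin T → (Fin T → Bool) → α) : Prop :=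
  ∀ (t : Fin T) (ys ys' : Fin T → Bool),
    (∀ s : Fin T, (s : ℕ) < (t : ℕ) → ys s = ys' s) → a t ys = a t ys'

lemma IsPredictable.comp {T : ℕ} {α β : Type*} {a : Fin T → (Fin T → Bool) → α}
    (ha : IsPredictable a) (f : α → β) : IsPredictable fun t ys => f (a t ys) :=
  fun t ys ys' h => congrArg f (ha t ys ys' h)

/-- The indicators that the observations `ys` agree with the predictions `a`. -/
def agreement {T : ℕ} (a : Fin T → (Fin T → Bool) → Bool) (ys : Fin T → Bool) :
    Fin T → Bool :=
  fun t => decide (ys t = a t ys)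

lemma IsPredictable.agreement_bijective {T : ℕ} {a : Fin T → (Fin T → Bool) → Bool}
    (ha : IsPredictable a) : Function.Bijective (agreement a) := by
  rw [← Finite.injective_iff_bijective]
  intro ys ys' h
  have key : ∀ n : ℕ, ∀ t : Fin T, (t : ℕ) = n → ys t = ys' t := by
    intro n
    induction n using Nat.strong_induction_on with
    | _ n ih =>
      intro t ht
      have h1 := ha t ys ys' fun s hs => ih s (ht ▸ hs) s rfl
      have h2 := congrFun h t
      simp only [agreement, h1] at h2
      revert h2
      cases ys t <;> cases ys' t <;> cases a t ys' <;> simp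
  exact funext fun t => key t t rfl

/-- Probability of the observations `ys` when round `t` correctly shows `a t ys` with
probability `1 - p`. -/
noncomputable def obsProb {T : ℕ} (p : ℝ) (a : Fin T → (Fin T → Bool) → Bool)
    (ys : Fin T → Bool) : ℝ :=
  ∏ t, correctWeight p (agreement a ys t)

lemma obsProb_pos {T : ℕ} {p : ℝ} (hp0 : 0 < p) (hp1 : p < 1 / 2)
    (a : Fin T → (Fin T → Bool) → Bool) (ys : Fin T → Bool) : 0 < obsProb p a ys :=
  Finset.prod_pos fun _ _ => correctWeight_pos hp0 hp1 _

lemma sum_prod_eq_one {T : ℕ} {r : Bool → ℝ} (hr : ∑ b, r b = 1) :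
    ∑ z : Fin T → Bool, ∏ t, r (z t) = 1 := by
  rw [← Fintype.piFinset_univ, ← Finset.prod_univ_sum (fun _ => Finset.univ) fun _ b => r b]
  simp only [hr, Finset.prod_const_one]

lemma sum_obsProb {T : ℕ} (p : ℝ) {a : Fin T → (Fin T → Bool) → Bool}
    (ha : IsPredictable a) : ∑ ys, obsProb p a ys = 1 := by
  rw [← sum_prod_eq_one (T := T) (sum_correctWeight p)]
  exact ha.agreement_bijective.sum_comp fun z => ∏ t, correctWeight p (z t)

lemma sum_prod_mul_sum {T : ℕ} {r : Bool → ℝ} (hr : ∑ b, r b = 1) (φ : Bool → ℝ) :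
    ∑ z : Fin T → Bool, (∏ t, r (z t)) * ∑ t, φ (z t) = T * ∑ b, r b * φ b := by
  simp_rw [Finset.mul_sum]
  rw [Finset.sum_comm]
  have key : ∀ s : Fin T,
      ∑ z : Fin T → Bool, (∏ t, r (z t)) * φ (z s) = ∑ b, r b * φ b := by
    intro s
    have h1 : ∀ z : Fin T → Bool,
        (∏ t, r (z t)) * φ (z s) = ∏ t, (r (z t) * if t = s then φ (z t) else 1) := by
      intro z
      rw [Finset.prod_mul_distrib]
      simp
    simp_rw [h1]
    rw [← Fintype.piFinset_univ, ← Finset.prod_univ_sum (fun _ => Finset.univ)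
      fun t b => r b * if t = s then φ b else 1]
    rw [Finset.prod_eq_single s]
    · simp
    · intro t _ hts
      simpa [hts] using hr
    · simp
  simp_rw [key]
  simp

/-- Divergence (in nats) of `T` adaptive observations from `T` fair coin flips. -/
lemma sum_obsProb_mul_log {T : ℕ} {p : ℝ} (hp0 : 0 < p) (hp1 : p < 1 / 2)
    {a : Fin T → (Fin T → Bool) → Bool} (ha : IsPredictable a) :
    ∑ ys, obsProb p a ys * Real.log (obsProb p a ys / (1 / 2) ^ T) =
      T * ((1 - binEnt p) * Real.log 2) := by
  have h1 := ha.agreement_bijective.sum_comp fun z =>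
    (∏ t, correctWeight p (z t)) * ∑ t, Real.log (correctWeight p (z t) * 2)
  rw [sum_prod_mul_sum (sum_correctWeight p) fun b => Real.log (correctWeight p b * 2)] at h1
  have h2 : ∑ b, correctWeight p b * Real.log (correctWeight p b * 2) =
      (1 - binEnt p) * Real.log 2 := by
    have hl : Real.log 2 ≠ 0 := (Real.log_pos one_lt_two).ne'
    simp only [Fintype.sum_bool, correctWeight, binEnt, Real.logb]
    simp only [if_true, Bool.false_eq_true, if_false]
    rw [Real.log_mul (by linarith) two_ne_zero, Real.log_mul hp0.ne' two_ne_zero]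
    field_simp
    ring
  rw [← h2, ← h1]
  refine Finset.sum_congr rfl fun ys _ => ?_
  have h3 : obsProb p a ys / (1 / 2) ^ T =
      ∏ t, (correctWeight p (agreement a ys t) * 2) := by
    rw [Finset.prod_mul_distrib]
    simp [obsProb]
  rw [h3, Real.log_prod fun t _ =>
    mul_ne_zero (correctWeight_pos hp0 hp1 _).ne' two_ne_zero]
  rfl

lemma sub_le_mul_log_div_sub {P U h : ℝ} (hP : 0 < P) (hU : 0 < U) :
    P - U * Real.exp h ≤ P * Real.log (P / U) - P * h := by
  have h1 := Real.log_le_sub_one_of_pos (x := U * Real.exp h / P) (by positivity)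
  rw [Real.log_div (by positivity) hP.ne', Real.log_mul hU.ne' (Real.exp_ne_zero _),
    Real.log_exp] at h1
  rw [Real.log_div hP.ne' hU.ne']
  have h2 := mul_le_mul_of_nonneg_left h1 hP.le
  have h3 : P * (U * Real.exp h / P - 1) = U * Real.exp h - P := by field_simp
  linarith

/-- Probability of not outputting `j`. -/
noncomputable def missProb {T : ℕ} (p : ℝ) (a : Fin T → (Fin T → Bool) → Bool)
    (out : (Fin T → Bool) → ℕ) (j : ℕ) : ℝ :=
  ∑ ys, obsProb p a ys * (if out ys = j then 0 else 1)

lemma missProb_nonneg {T : ℕ} {p : ℝ} (hp0 : 0 < p) (hp1 : p < 1 / 2)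
    (a : Fin T → (Fin T → Bool) → Bool) (out : (Fin T → Bool) → ℕ) (j : ℕ) :
    0 ≤ missProb p a out j :=
  Finset.sum_nonneg fun ys _ =>
    mul_nonneg (obsProb_pos hp0 hp1 a ys).le (by split_ifs <;> norm_num)

lemma missProb_le_one {T : ℕ} {p : ℝ} (hp0 : 0 < p) (hp1 : p < 1 / 2)
    {a : Fin T → (Fin T → Bool) → Bool} (ha : IsPredictable a)
    (out : (Fin T → Bool) → ℕ) (j : ℕ) : missProb p a out j ≤ 1 := by
  rw [← sum_obsProb p ha]
  exact Finset.sum_le_sum fun ys _ =>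
    mul_le_of_le_one_right (obsProb_pos hp0 hp1 a ys).le (by split_ifs <;> norm_num)

/-- Change of measure from the true law to fair coin flips, tested against `out = j`. -/
lemma missProb_change_of_measure {T : ℕ} {p : ℝ} (hp0 : 0 < p) (hp1 : p < 1 / 2)
    {a : Fin T → (Fin T → Bool) → Bool} (ha : IsPredictable a)
    (out : (Fin T → Bool) → ℕ) (j : ℕ) {κ : ℝ} (hκ : 0 < κ) :
    1 - ∑ ys, (1 / 2 : ℝ) ^ T * (if out ys = j then κ else κ⁻¹) ≤
      T * ((1 - binEnt p) * Real.log 2) - Real.log κ * (1 - 2 * missProb p a out j) := by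
  have h1 := Finset.sum_le_sum fun ys (_ : ys ∈ (Finset.univ : Finset (Fin T → Bool))) =>
    sub_le_mul_log_div_sub (obsProb_pos hp0 hp1 a ys)
      (show (0 : ℝ) < (1 / 2) ^ T by positivity)
      (h := if out ys = j then Real.log κ else -Real.log κ)
  rw [Finset.sum_sub_distrib, Finset.sum_sub_distrib, sum_obsProb p ha,
    sum_obsProb_mul_log hp0 hp1 ha] at h1
  have h2 : ∀ ys, Real.exp (if out ys = j then Real.log κ else -Real.log κ) =
      if out ys = j then κ else κ⁻¹ := by
    intro ys
    split_ifs
    · exact Real.exp_log hκ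
    · rw [Real.exp_neg, Real.exp_log hκ]
  have h3 : ∑ ys, obsProb p a ys * (if out ys = j then Real.log κ else -Real.log κ) =
      Real.log κ * (1 - 2 * missProb p a out j) := by
    rw [← sum_obsProb p ha, missProb, Finset.mul_sum, ← Finset.sum_sub_distrib, Finset.mul_sum]
    refine Finset.sum_congr rfl fun ys _ => ?_
    split_ifs <;> ring
  simp_rw [h2] at h1
  rwa [h3] at h1

lemma sum_ite_out_le {K : ℕ} {κ : ℝ} (hκ : 1 ≤ κ) (n : ℕ) :
    ∑ j : Fin (K + 1), (if n = (j : ℕ) then κ else κ⁻¹) ≤ κ + K * κ⁻¹ := by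
  have hinv : κ⁻¹ ≤ κ := (inv_le_one_of_one_le₀ hκ).trans hκ
  by_cases hn : n < K + 1
  · rw [← Finset.add_sum_erase _ _ (Finset.mem_univ (⟨n, hn⟩ : Fin (K + 1)))]
    rw [Finset.sum_congr rfl (g := fun _ => κ⁻¹)]
    · simp
    · intro j hj
      rw [if_neg]
      rintro h
      exact (Finset.ne_of_mem_erase hj) (Fin.ext h.symm)
  · rw [Finset.sum_congr rfl (g := fun _ => κ⁻¹)]
    · simp
      linarith
    · intro j _
      rw [if_neg]
      have := j.2
      omega

lemma sum_half_pow (T : ℕ) : ∑ _ys : Fin T → Bool, (1 / 2 : ℝ) ^ T = 1 := by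
  simp

/-- Fano-type bound for the sum of the error probabilities over `K + 1` hypotheses. -/
lemma fano_sum_missProb {K T : ℕ} (hK : 2 ≤ K) {p : ℝ} (hp0 : 0 < p) (hp1 : p < 1 / 2)
    {a : Fin (K + 1) → Fin T → (Fin T → Bool) → Bool} (ha : ∀ j, IsPredictable (a j))
    (out : (Fin T → Bool) → ℕ) :
    (K + 1) * (1 - T * (1 - binEnt p) / Real.logb 2 K) ≤
      2 * ∑ j : Fin (K + 1), missProb p (a j) out j := by
  have hK' : (2 : ℝ) ≤ K := by exact_mod_cast hK
  have hKpos : (0 : ℝ) < K := by linarith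
  have hlog : 0 < Real.log K := Real.log_pos (by linarith)
  have h1 := Finset.sum_le_sum fun j (_ : j ∈ (Finset.univ : Finset (Fin (K + 1)))) =>
    missProb_change_of_measure hp0 hp1 (ha j) out j hKpos
  have h2 : ∑ j : Fin (K + 1), ∑ ys, (1 / 2 : ℝ) ^ T *
      (if out ys = (j : ℕ) then (K : ℝ) else (K : ℝ)⁻¹) ≤ K + 1 := by
    rw [Finset.sum_comm]
    calc _ ≤ ∑ _ys : Fin T → Bool, (1 / 2 : ℝ) ^ T * (K + 1) := by
          refine Finset.sum_le_sum fun ys _ => ?_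
          rw [← Finset.mul_sum]
          refine mul_le_mul_of_nonneg_left ?_ (by positivity)
          have := sum_ite_out_le (K := K) (κ := K) (by linarith) (out ys)
          rwa [mul_inv_cancel₀ hKpos.ne'] at this
      _ = K + 1 := by rw [← Finset.sum_mul, sum_half_pow, one_mul]
  simp only [Finset.sum_sub_distrib, ← Finset.mul_sum] at h1 h2
  simp only [Finset.sum_const, Finset.card_univ, Fintype.card_fin, nsmul_eq_mul, mul_one,
    Nat.cast_add, Nat.cast_one] at h1
  have h4 : (T : ℝ) * (1 - binEnt p) / Real.logb 2 K =
      T * ((1 - binEnt p) * Real.log 2) / Real.log K := by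
    rw [Real.logb]
    field_simp
  rw [h4]
  set c := (T : ℝ) * ((1 - binEnt p) * Real.log 2)
  set S := ∑ j : Fin (K + 1), missProb p (a j) out j
  have h5 : (K + 1) * (1 - c / Real.log K) = (K + 1) * (Real.log K - c) / Real.log K := by
    field_simp
  rw [h5, div_le_iff₀ hlog]
  linarith

/-- Two-point bound for hypotheses that disagree on every comparison. -/
lemma two_point_missProb {T : ℕ} {p : ℝ} (hp0 : 0 < p) (hp1 : p < 1 / 2)
    {a b : Fin T → (Fin T → Bool) → Bool} (ha : IsPredictable a) (hb : IsPredictable b)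
    (hab : ∀ t ys, a t ys = !b t ys) (out : (Fin T → Bool) → ℕ) {i j : ℕ} (hij : i ≠ j) :
    (4 * (p * (1 - p))) ^ T ≤ 2 * (missProb p a out i + missProb p b out j) := by
  set m : (Fin T → Bool) → ℝ := fun ys => if out ys = i then obsProb p b ys else obsProb p a ys
  set M : (Fin T → Bool) → ℝ := fun ys => if out ys = i then obsProb p a ys else obsProb p b ys
  have hPa := fun ys => obsProb_pos hp0 hp1 a ys
  have hPb := fun ys => obsProb_pos hp0 hp1 b ys
  have hm : ∀ ys, 0 ≤ m ys := fun ys => by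
    simp only [m]; split_ifs; exacts [(hPb ys).le, (hPa ys).le]
  have hM : ∀ ys, 0 ≤ M ys := fun ys => by
    simp only [M]; split_ifs; exacts [(hPa ys).le, (hPb ys).le]
  have hprod : ∀ ys, obsProb p a ys * obsProb p b ys = (p * (1 - p)) ^ T := by
    intro ys
    rw [obsProb, obsProb, ← Finset.prod_mul_distrib]
    rw [Finset.prod_congr rfl (g := fun _ => p * (1 - p))]
    · simp
    · intro t _
      simp only [agreement, hab]
      rcases ys t <;> rcases b t ys <;> simp [correctWeight, mul_comm]
  have hpp : 0 < p * (1 - p) := mul_pos hp0 (by linarith)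
  have hsq : ∀ ys, (Real.sqrt (p * (1 - p)) ^ T) ^ 2 = m ys * M ys := by
    intro ys
    rw [← pow_mul, mul_comm T 2, pow_mul, Real.sq_sqrt hpp.le, ← hprod ys]
    simp only [m, M]
    split_ifs
    · ring
    · rfl
  have hcs := Finset.sum_sq_le_sum_mul_sum_of_sq_le_mul
    (Finset.univ : Finset (Fin T → Bool)) (r := fun _ => Real.sqrt (p * (1 - p)) ^ T)
    (fun ys _ => hm ys) (fun ys _ => hM ys) (fun ys _ => (hsq ys).le)
  have hleft : (∑ _ys : Fin T → Bool, Real.sqrt (p * (1 - p)) ^ T) ^ 2 =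
      (4 * (p * (1 - p))) ^ T := by
    simp only [Finset.sum_const, Finset.card_univ, Fintype.card_fun, Fintype.card_bool,
      Fintype.card_fin, nsmul_eq_mul, Nat.cast_pow, Nat.cast_ofNat]
    rw [← mul_pow, ← pow_mul, mul_comm T 2, pow_mul, mul_pow, Real.sq_sqrt hpp.le]
    norm_num
  have hM2 : ∑ ys, M ys ≤ 2 := by
    have : (2 : ℝ) = ∑ ys, (obsProb p a ys + obsProb p b ys) := by
      rw [Finset.sum_add_distrib, sum_obsProb p ha, sum_obsProb p hb]; norm_num
    rw [this]
    refine Finset.sum_le_sum fun ys _ => ?_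
    simp only [M]
    split_ifs <;> linarith [hPa ys, hPb ys]
  have hmS : ∑ ys, m ys ≤ missProb p a out i + missProb p b out j := by
    rw [missProb, missProb, ← Finset.sum_add_distrib]
    refine Finset.sum_le_sum fun ys _ => ?_
    simp only [m]
    by_cases h : out ys = i
    · simp [h, hij]
    · have := hPb ys
      simp only [h, if_false]
      split_ifs <;> linarith
  rw [hleft] at hcs
  calc _ ≤ (∑ ys, m ys) * ∑ ys, M ys := hcs
    _ ≤ (∑ ys, m ys) * 2 :=
        mul_le_mul_of_nonneg_left hM2 (Finset.sum_nonneg fun ys _ => hm ys)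
    _ ≤ _ := by linarith

lemma exp_neg_klBer_le {p : ℝ} (hp0 : 0 < p) (hp1 : p < 1 / 2) :
    Real.exp (-klBer p) ≤ 4 * (p * (1 - p)) := by
  have hq : 0 < 1 - p := by linarith
  set L := Real.log ((1 - p) / p)
  have hL : Real.exp L = (1 - p) / p := Real.exp_log (by positivity)
  have hconv := convexOn_exp.2 (Set.mem_univ (-(L / 2))) (Set.mem_univ (L / 2)) hq.le hp0.le
    (by ring)
  simp only [smul_eq_mul] at hconv
  set s := Real.exp (L / 2)
  have hs : 0 < s := Real.exp_pos _
  have hs2 : s ^ 2 = (1 - p) / p := by rw [← hL, ← Real.exp_nat_mul]; congr 1; push_cast; ring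
  have hps : p * s ^ 2 = 1 - p := by rw [hs2]; field_simp
  have hr : (1 - p) * Real.exp (-(L / 2)) + p * s = 2 * p * s := by
    rw [Real.exp_neg, ← hps]
    field_simp
    ring
  rw [hr] at hconv
  have h1 : Real.exp (-klBer p) = Real.exp ((1 - p) * -(L / 2) + p * (L / 2)) ^ 2 := by
    rw [← Real.exp_nat_mul, klBer]
    congr 1
    push_cast
    ring
  rw [h1]
  calc _ ≤ (2 * p * s) ^ 2 := pow_le_pow_left₀ (Real.exp_pos _).le hconv 2
    _ = 4 * (p * (p * s ^ 2)) := by ring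
    _ = _ := by rw [hps]

lemma exists_target {K : ℕ} {Xs : Fin K → ℝ} (hXs : StrictMono Xs) (j : ℕ) :
    ∃ x : ℝ, (∀ i, x ≠ Xs i) ∧ ∀ i : Fin K, Xs i < x ↔ (i : ℕ) < j := by
  obtain ⟨x, hlo, hhi⟩ := Order.exists_between_finsets
    ((Finset.univ.filter fun i : Fin K => (i : ℕ) < j).image Xs)
    ((Finset.univ.filter fun i : Fin K => ¬ (i : ℕ) < j).image Xs)
    (by
      simp only [Finset.mem_image, Finset.mem_filter, Finset.mem_univ, true_and]
      rintro _ ⟨i, hi, rfl⟩ _ ⟨k, hk, rfl⟩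
      exact hXs (Fin.lt_def.2 (by omega)))
  simp only [Finset.mem_image, Finset.mem_filter, Finset.mem_univ, true_and,
    forall_exists_index, and_imp, forall_apply_eq_imp_iff₂] at hlo hhi
  refine ⟨x, fun i => ?_, fun i => ⟨fun h => ?_, hlo i⟩⟩
  · by_cases hi : (i : ℕ) < j
    exacts [(hlo i hi).ne', (hhi i hi).ne]
  · by_contra hi
    exact (hhi i hi).not_gt h

lemma searchIdx_eq {K : ℕ} {Xs : Fin K → ℝ} {x : ℝ} {j : ℕ} (hj : j ≤ K)
    (h : ∀ i : Fin K, Xs i < x ↔ (i : ℕ) < j) : searchIdx Xs x = j := by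
  rw [searchIdx]
  simp only [h, Fin.card_filter_val_lt]
  omega

lemma detErrSEARCH_eq_missProb {K T : ℕ} (p : ℝ) (q : Fin T → (Fin T → Bool) → Fin K)
    (out : (Fin T → Bool) → ℕ) (Xs : Fin K → ℝ) (x : ℝ) :
    detErrSEARCH K T p q out Xs x =
      missProb p (fun t ys => decide (x > Xs (q t ys))) out (searchIdx Xs x) := by
  simp [detErrSEARCH, missProb, obsProb, agreement, correctWeight]

/-- Lower bound for the adaptive noisy search problem.  For any known sorted values
`Xs`, any (possibly randomized, via a seed `ω` drawn with probability `w ω`)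
adaptive `T`-round algorithm has worst-case error probability, over targets `x`
distinct from all `Xs i`, at least
`(1/4)·max(exp(-T·D_KL(p‖1-p)), 1 - T(1-H(p))/log₂ K)`. -/
theorem search_adaptive_lower_bound
    (K T : ℕ) (hK : 2 ≤ K) (p : ℝ) (hp0 : 0 < p) (hp1 : p < 1 / 2)
    (Xs : Fin K → ℝ) (hXs : StrictMono Xs)
    (Ω : Type) [Fintype Ω] (w : Ω → ℝ) (hw0 : ∀ ω, 0 ≤ w ω) (hw1 : ∑ ω, w ω = 1)
    (q : Ω → Fin T → (Fin T → Bool) → Fin K)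
    (hq : ∀ (ω : Ω) (t : Fin T) (ys ys' : Fin T → Bool),
      (∀ s : Fin T, (s : ℕ) < (t : ℕ) → ys s = ys' s) → q ω t ys = q ω t ys')
    (out : Ω → (Fin T → Bool) → ℕ) :
    (1 / 4 : ℝ) *
        max (Real.exp (-((T : ℝ) * klBer p)))
          (1 - (T : ℝ) * (1 - binEnt p) / Real.logb 2 (K : ℝ)) ≤
      ⨆ x : {x : ℝ // ∀ i, x ≠ Xs i},
        ∑ ω, w ω * detErrSEARCH K T p (q ω) (out ω) Xs x.1 := by
  have ha : ∀ ω (x : ℝ), IsPredictable fun t ys => decide (x > Xs (q ω t ys)) :=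
    fun ω x => IsPredictable.comp (hq ω) fun i => decide (x > Xs i)
  set R : {x : ℝ // ∀ i, x ≠ Xs i} → ℝ :=
    fun x => ∑ ω, w ω * detErrSEARCH K T p (q ω) (out ω) Xs x.1 with hR
  have hbdd : BddAbove (Set.range R) := by
    refine ⟨1, ?_⟩
    rintro _ ⟨x, rfl⟩
    rw [← hw1]
    refine Finset.sum_le_sum fun ω _ => mul_le_of_le_one_right (hw0 ω) ?_
    rw [detErrSEARCH_eq_missProb]
    exact missProb_le_one hp0 hp1 (ha ω x) _ _
  have hle : ∀ x, R x ≤ ⨆ x, R x := le_ciSup hbdd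
  choose X hX hXlt using exists_target hXs
  have hRX : ∀ j ≤ K, R ⟨X j, hX j⟩ =
      ∑ ω, w ω * missProb p (fun t ys => decide (X j > Xs (q ω t ys))) (out ω) j := by
    intro j hj
    simp only [hR, detErrSEARCH_eq_missProb, searchIdx_eq hj (hXlt j)]
  have hnonneg : 0 ≤ ⨆ x, R x := by
    refine le_trans ?_ (hle ⟨X 0, hX 0⟩)
    rw [hRX 0 K.zero_le]
    exact Finset.sum_nonneg fun ω _ => mul_nonneg (hw0 ω) (missProb_nonneg hp0 hp1 _ _ _)
  have havg : ∀ c : ℝ, ∑ ω, w ω * c = c := fun c => by rw [← Finset.sum_mul, hw1, one_mul]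
  have htwo : Real.exp (-((T : ℝ) * klBer p)) ≤ 4 * ⨆ x, R x := by
    calc Real.exp (-((T : ℝ) * klBer p)) = Real.exp (-klBer p) ^ T := by
          rw [← Real.exp_nat_mul]; congr 1; ring
      _ ≤ (4 * (p * (1 - p))) ^ T :=
          pow_le_pow_left₀ (Real.exp_pos _).le (exp_neg_klBer_le hp0 hp1) T
      _ = ∑ ω, w ω * (4 * (p * (1 - p))) ^ T := (havg _).symm
      _ ≤ ∑ ω, w ω *
          (2 * (missProb p (fun t ys => decide (X 0 > Xs (q ω t ys))) (out ω) 0 +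
            missProb p (fun t ys => decide (X K > Xs (q ω t ys))) (out ω) K)) := by
          refine Finset.sum_le_sum fun ω _ => mul_le_mul_of_nonneg_left ?_ (hw0 ω)
          refine two_point_missProb hp0 hp1 (ha ω _) (ha ω _) (fun t ys => ?_) _ (by omega)
          simp [hXlt]
      _ = 2 * (R ⟨X 0, hX 0⟩ + R ⟨X K, hX K⟩) := by
          rw [hRX 0 K.zero_le, hRX K le_rfl, ← Finset.sum_add_distrib, Finset.mul_sum]
          exact Finset.sum_congr rfl fun ω _ => by ring
      _ ≤ 4 * ⨆ x, R x := by linarith [hle ⟨X 0, hX 0⟩, hle ⟨X K, hX K⟩]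
  have hfano : 1 - (T : ℝ) * (1 - binEnt p) / Real.logb 2 (K : ℝ) ≤ 2 * ⨆ x, R x := by
    have hK1 : (0 : ℝ) < K + 1 := by positivity
    refine le_of_mul_le_mul_left ?_ hK1
    calc (K + 1 : ℝ) * (1 - (T : ℝ) * (1 - binEnt p) / Real.logb 2 (K : ℝ))
        = ∑ ω, w ω * ((K + 1 : ℝ) * (1 - (T : ℝ) * (1 - binEnt p) / Real.logb 2 (K : ℝ))) :=
          (havg _).symm
      _ ≤ ∑ ω, w ω * (2 * ∑ j : Fin (K + 1),
            missProb p (fun t ys => decide (X j > Xs (q ω t ys))) (out ω) j) :=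
          Finset.sum_le_sum fun ω _ => mul_le_mul_of_nonneg_left
            (fano_sum_missProb hK hp0 hp1 (fun j : Fin (K + 1) => ha ω (X j)) _) (hw0 ω)
      _ = 2 * ∑ j : Fin (K + 1), R ⟨X j, hX j⟩ := by
          rw [Finset.sum_congr rfl fun (j : Fin (K + 1)) _ => hRX j (by have := j.2; omega),
            Finset.sum_comm, Finset.mul_sum]
          refine Finset.sum_congr rfl fun ω _ => ?_
          rw [← Finset.mul_sum]
          ring
      _ ≤ 2 * ∑ _j : Fin (K + 1), ⨆ x, R x := by
          gcongr
          exact hle _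
      _ = (K + 1 : ℝ) * (2 * ⨆ x, R x) := by
          simp
          ring
  have hmax := max_le htwo (hfano.trans (by linarith : 2 * ⨆ x, R x ≤ 4 * ⨆ x, R x))
  linarith
end

section
/- For every K ≥ 2, p ∈ (0,1/2) and T ≥ 0, any non-adaptive T-round algorithm for sorting K items from noisy pairwise comparisons satisfies sup over instances θ (assignments of K distinct real values) of P(μ̂ ≠ SORT(θ)) ≥ (1/2)·(1 − (4T·D_KL(p‖1−p)/K² + ln 2)/ln K). Consequently, any such algorithm whose worst-case error probability is at most 1/3 must use T = Ω(K²·log(K)/D_KL(p‖1−p)) queries, i.e. there is a universal constant c > 0 with T ≥ c·K²·ln(K)/D_KL(p‖1−p). -/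
open Classical in
/-- Error probability of a non-adaptive `T`-round strategy for sorting `K` items with
values `θ : Fin K → ℝ` from noisy pairwise comparisons.  The strategy fixes in
advance a sequence of distributions `π t` over ordered pairs; at round `t` the
queried pair `ks t` is drawn from `π t` independently of everything else, and the
indicator of `θ (ks t).1 > θ (ks t).2` flipped independently with probability `p` is
observed.  The output rule `out` sees the queried pairs and the observations, and
the algorithm errs unless its output permutation `σ` satisfies
`θ(σ 0) < θ(σ 1) < ⋯ < θ(σ (K-1))`. -/
noncomputable def naErrSORT (K T : ℕ) (p : ℝ)
    (π : Fin T → Fin K × Fin K → ℝ)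
    (out : (Fin T → Fin K × Fin K) → (Fin T → Bool) → Equiv.Perm (Fin K))
    (θ : Fin K → ℝ) : ℝ :=
  ∑ ks : Fin T → Fin K × Fin K, ∑ ys : Fin T → Bool,
    (∏ t : Fin T,
        π t (ks t) * (if ys t = decide (θ (ks t).1 > θ (ks t).2) then 1 - p else p)) *
      (if StrictMono (fun i => θ (out ks ys i)) then 0 else 1)

lemma sum_pi_prod {T : ℕ} {α : Type*} [Fintype α] (f : Fin T → α → ℝ) :
    ∑ x : Fin T → α, ∏ t, f t (x t) = ∏ t, ∑ a, f t a := by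
  classical
  rw [Finset.prod_univ_sum, Fintype.piFinset_univ]

/-- The expectation of an additive function of independent coordinates. -/
lemma sum_pi_prod_mul_sum {T : ℕ} {α : Type*} [Fintype α] (f h : Fin T → α → ℝ)
    (hf : ∀ t, ∑ a, f t a = 1) :
    ∑ x : Fin T → α, (∏ t, f t (x t)) * ∑ t, h t (x t) = ∑ t, ∑ a, f t a * h t a := by
  classical
  simp_rw [Finset.mul_sum]
  rw [Finset.sum_comm]
  refine Finset.sum_congr rfl fun s _ => ?_
  have h1 : ∀ x : Fin T → α, (∏ t, f t (x t)) * h s (x s) =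
      ∏ t, (f t (x t) * if t = s then h t (x t) else 1) := by
    intro x
    rw [Finset.prod_mul_distrib, Finset.prod_ite_eq' Finset.univ s]
    simp
  simp_rw [h1]
  rw [sum_pi_prod (fun t a => f t a * if t = s then h t a else 1)]
  rw [Finset.prod_eq_single s]
  · simp
  · intro t _ hts
    simp [hts, hf]
  · simp

/-- Young-type inequality behind the Donsker–Varadhan variational formula. -/
lemma mul_sub_log_div_le {a b : ℝ} (ha : 0 < a) (hb : 0 < b) (g c : ℝ) :
    a * (g - Real.log (a / b) - c) ≤ b * Real.exp (g - c) - a := by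
  have h := Real.add_one_le_exp (g - Real.log (a / b) - c)
  have h2 : Real.exp (g - Real.log (a / b) - c) = Real.exp (g - c) * (b / a) := by
    rw [show g - Real.log (a / b) - c = (g - c) - Real.log (a / b) by ring, Real.exp_sub,
      Real.exp_log (by positivity)]
    field_simp
  rw [h2] at h
  have h3 := mul_le_mul_of_nonneg_left h ha.le
  have h4 : a * (Real.exp (g - c) * (b / a)) = b * Real.exp (g - c) := by field_simp
  rw [h4] at h3
  linarith

/-- Fano's inequality for finitely many hypotheses `a j` compared with a reference `b`, all given
by densities with respect to the weights `W`. -/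
lemma fano_inequality {J Z : Type*} [Fintype J] [Nonempty J] [Fintype Z]
    (W : Z → ℝ) (hW : ∀ z, 0 ≤ W z) (a : J → Z → ℝ) (ha : ∀ j z, 0 < a j z)
    (b : Z → ℝ) (hb : ∀ z, 0 < b z) (hWb : ∑ z, W z * b z = 1)
    (hWa : ∀ j, ∑ z, W z * a j z = 1) (G : J → Z → Prop) [∀ j z, Decidable (G j z)]
    (hG : ∀ z j j', G j z → G j' z → j = j') :
    (∑ j, ∑ z, W z * a j z * (if G j z then 1 else 0)) * Real.log (Fintype.card J) ≤
      ∑ j, ∑ z, W z * (a j z * Real.log (a j z / b z)) +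
        Fintype.card J * Real.log (2 - 1 / Fintype.card J) := by
  set K : ℝ := (Fintype.card J : ℝ) with hK
  have hK1 : (1 : ℝ) ≤ K := by
    rw [hK]; exact_mod_cast Fintype.card_pos (α := J)
  have hK0 : 0 < K := by linarith
  have hq : 0 < 2 - 1 / K := by
    have : 1 / K ≤ 1 := by rw [div_le_one hK0]; exact hK1
    linarith
  set c := Real.log (2 - 1 / K) with hc
  have hexp : ∀ j z, Real.exp ((if G j z then 1 else 0) * Real.log K - c) =
      (1 + (K - 1) * (if G j z then 1 else 0)) / (2 - 1 / K) := by
    intro j z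
    rw [Real.exp_sub, hc, Real.exp_log hq]
    split_ifs
    · rw [one_mul, Real.exp_log hK0]; ring_nf
    · simp
  have hcount : ∀ z, ∑ j, (if G j z then (1 : ℝ) else 0) ≤ 1 := by
    intro z
    rw [Finset.sum_boole]
    exact_mod_cast Finset.card_le_one.2 fun x hx y hy =>
      hG z x y (Finset.mem_filter.1 hx).2 (Finset.mem_filter.1 hy).2
  have hpt : ∀ j z, W z * (a j z * ((if G j z then 1 else 0) * Real.log K
      - Real.log (a j z / b z) - c)) ≤
      W z * b z / (2 - 1 / K) * (1 + (K - 1) * (if G j z then 1 else 0)) - W z * a j z := by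
    intro j z
    have := mul_le_mul_of_nonneg_left (mul_sub_log_div_le (ha j z) (hb z)
      ((if G j z then 1 else 0) * Real.log K) c) (hW z)
    rw [hexp] at this
    refine this.trans (le_of_eq ?_)
    ring
  have hz : ∀ z, ∑ j, W z * b z / (2 - 1 / K) * (1 + (K - 1) * (if G j z then (1 : ℝ) else 0)) ≤
      W z * b z * K := by
    intro z
    rw [← Finset.mul_sum, Finset.sum_add_distrib, ← Finset.mul_sum]
    have h1 : ∑ _j : J, (1 : ℝ) = K := by simp [hK]
    rw [h1]
    have h2 : (K - 1) * ∑ j, (if G j z then (1 : ℝ) else 0) ≤ (K - 1) * 1 :=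
      mul_le_mul_of_nonneg_left (hcount z) (by linarith)
    have h3 : 0 ≤ W z * b z / (2 - 1 / K) :=
      div_nonneg (mul_nonneg (hW z) (hb z).le) hq.le
    refine (mul_le_mul_of_nonneg_left (add_le_add_right h2 K) h3).trans (le_of_eq ?_)
    rw [div_mul_eq_mul_div, div_eq_iff hq.ne']
    field_simp
    ring
  have hsum : ∑ j, ∑ z, W z * (a j z * ((if G j z then 1 else 0) * Real.log K
      - Real.log (a j z / b z) - c)) ≤ 0 := by
    calc _ ≤ ∑ j, ∑ z, (W z * b z / (2 - 1 / K) * (1 + (K - 1) * (if G j z then (1 : ℝ) else 0))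
          - W z * a j z) := Finset.sum_le_sum fun j _ => Finset.sum_le_sum fun z _ => hpt j z
      _ = ∑ z, ∑ j, W z * b z / (2 - 1 / K) * (1 + (K - 1) * (if G j z then (1 : ℝ) else 0))
          - K := by
        simp_rw [Finset.sum_sub_distrib, hWa]
        rw [Finset.sum_comm]
        simp [hK]
      _ ≤ ∑ z, W z * b z * K - K := by
        gcongr with z
        exact hz z
      _ = 0 := by rw [← Finset.sum_mul, hWb]; ring
  have hexpand : ∑ j, ∑ z, W z * (a j z * ((if G j z then 1 else 0) * Real.log K
      - Real.log (a j z / b z) - c)) =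
      (∑ j, ∑ z, W z * a j z * (if G j z then 1 else 0)) * Real.log K -
      ∑ j, ∑ z, W z * (a j z * Real.log (a j z / b z)) - K * c := by
    have h1 : K * c = ∑ j, ∑ z, W z * a j z * c := by
      simp_rw [← Finset.sum_mul, hWa]
      simp [hK]
    rw [h1, Finset.sum_mul]
    simp_rw [Finset.sum_mul, ← Finset.sum_sub_distrib]
    refine Finset.sum_congr rfl fun j _ => Finset.sum_congr rfl fun z _ => ?_
    ring
  rw [hexpand] at hsum
  linarith

/-- Likelihood of the observations `ys` when the noiseless answers are `c t`. -/
noncomputable def flipLik {T : ℕ} (p : ℝ) (c : Fin T → Bool) (ys : Fin T → Bool) : ℝ :=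
  ∏ t, if ys t = c t then 1 - p else p

lemma flipLik_pos {T : ℕ} {p : ℝ} (hp : 0 < p) (hp' : p < 1 / 2) (c ys : Fin T → Bool) :
    0 < flipLik p c ys := by
  refine Finset.prod_pos fun t _ => ?_
  split_ifs <;> linarith

lemma sum_flip (p : ℝ) (c : Bool) : ∑ y : Bool, (if y = c then 1 - p else p) = 1 := by
  cases c <;> simp

lemma sum_flipLik {T : ℕ} (p : ℝ) (c : Fin T → Bool) : ∑ ys, flipLik p c ys = 1 := by
  unfold flipLik
  rw [sum_pi_prod (fun t y => if y = c t then 1 - p else p)]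
  simp_rw [sum_flip]
  simp

lemma sum_flipLik_mul_log {T : ℕ} {p : ℝ} (hp : 0 < p) (hp' : p < 1 / 2) (c d : Fin T → Bool) :
    ∑ ys, flipLik p c ys * Real.log (flipLik p c ys / flipLik p d ys) =
      ∑ t, if c t = d t then 0 else klBer p := by
  have hq : 0 < 1 - p := by linarith
  have hpos : ∀ (e y : Bool), (if y = e then 1 - p else p) ≠ 0 := by
    intro e y
    split_ifs <;> linarith
  have hlog : ∀ ys, Real.log (flipLik p c ys / flipLik p d ys) =
      ∑ t, Real.log ((if ys t = c t then 1 - p else p) / (if ys t = d t then 1 - p else p)) := by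
    intro ys
    unfold flipLik
    rw [← Finset.prod_div_distrib, Real.log_prod]
    intro t _
    exact div_ne_zero (hpos _ _) (hpos _ _)
  simp_rw [hlog]
  unfold flipLik
  rw [sum_pi_prod_mul_sum (fun t y => if y = c t then 1 - p else p)
    (fun t y => Real.log ((if y = c t then 1 - p else p) / (if y = d t then 1 - p else p)))
    (fun t => sum_flip p (c t))]
  refine Finset.sum_congr rfl fun t _ => ?_
  have h3 : Real.log (p / (1 - p)) = - Real.log ((1 - p) / p) := by
    rw [← Real.log_inv, inv_div]
  cases c t <;> cases d t <;> simp [klBer, h3] <;> ring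

/-- The transposition of the rank `j` with the preceding one; trivial for `j = 0`. -/
def swapPred {K : ℕ} (j : Fin K) : Equiv.Perm (Fin K) :=
  Equiv.swap j ⟨j.1 - 1, by omega⟩

lemma swapPred_injective {K : ℕ} : Function.Injective (swapPred (K := K)) := by
  have key : ∀ j j' : Fin K, j < j' → swapPred j ≠ swapPred j' := by
    intro j j' h he
    have := congrArg (fun e : Equiv.Perm (Fin K) => (e j').1) he
    simp only [swapPred, Equiv.swap_apply_def, Fin.ext_iff] at this
    have h' : j.1 < j'.1 := h
    split_ifs at this <;> simp at * <;> omega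
  intro j j' he
  rcases lt_trichotomy j j' with h | h | h
  · exact absurd he (key _ _ h)
  · exact h
  · exact absurd he.symm (key _ _ h)

/-- The instance ranking the items by `σ`. -/
def rankInstance {K : ℕ} (σ : Equiv.Perm (Fin K)) (x : Fin K) : ℝ := ((σ x).1 : ℝ)

lemma rankInstance_injective {K : ℕ} (σ : Equiv.Perm (Fin K)) :
    Function.Injective (rankInstance σ) := by
  intro x y h
  unfold rankInstance at h
  exact σ.injective (Fin.ext (by exact_mod_cast h))

lemma eq_inv_of_strictMono_rankInstance {K : ℕ} {σ ρ : Equiv.Perm (Fin K)}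
    (h : StrictMono fun i => rankInstance σ (ρ i)) : σ = ρ⁻¹ := by
  have h1 : StrictMono fun i => σ (ρ i) := by
    intro x y hxy
    have := h hxy
    simp only [rankInstance] at this
    exact Fin.lt_def.2 (by exact_mod_cast this)
  have h2 : (fun i => σ (ρ i)) = id := by
    have : Set.range (fun i => σ (ρ i)) = Set.range (id : Fin K → Fin K) := by
      rw [Set.range_id, Set.range_eq_univ]
      exact σ.surjective.comp ρ.surjective
    exact (StrictMono.range_inj h1 strictMono_id).1 this
  rw [eq_inv_iff_mul_eq_one]
  ext i
  have := congrFun h2 i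
  simp only [id] at this
  simp [this]

/-- The noiseless answer to the query `k`. -/
noncomputable def answer {K : ℕ} (θ : Fin K → ℝ) (k : Fin K × Fin K) : Bool :=
  decide (θ k.1 > θ k.2)

lemma adjacent_of_answer_ne {K : ℕ} (σ : Equiv.Perm (Fin K)) (j : Fin K) (k : Fin K × Fin K)
    (h : answer (rankInstance (swapPred j * σ)) k ≠ answer (rankInstance σ) k) :
    ((σ k.2).1 + 1 = (σ k.1).1 ∧ j = σ k.1) ∨ ((σ k.1).1 + 1 = (σ k.2).1 ∧ j = σ k.2) := by
  simp only [answer, rankInstance, gt_iff_lt, Nat.cast_lt, Equiv.Perm.mul_apply, swapPred,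
    Equiv.swap_apply_def, ne_eq, decide_eq_decide, Fin.ext_iff] at h
  simp only [Fin.ext_iff]
  split_ifs at h <;> simp at * <;> omega

lemma sum_answer_ne_le {K : ℕ} (σ : Equiv.Perm (Fin K)) (k : Fin K × Fin K) :
    ∑ j, (if answer (rankInstance (swapPred j * σ)) k = answer (rankInstance σ) k
      then (0 : ℝ) else 1) ≤
    (if (σ k.2).1 + 1 = (σ k.1).1 then 1 else 0) +
      (if (σ k.1).1 + 1 = (σ k.2).1 then 1 else 0) := by
  calc _ ≤ ∑ j, ((if j = σ k.1 then (if (σ k.2).1 + 1 = (σ k.1).1 then (1 : ℝ) else 0) else 0) +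
        (if j = σ k.2 then (if (σ k.1).1 + 1 = (σ k.2).1 then (1 : ℝ) else 0) else 0)) := by
        refine Finset.sum_le_sum fun j _ => ?_
        split_ifs with h
        all_goals first
          | (norm_num; done)
          | (exfalso; rcases adjacent_of_answer_ne σ j k h with ⟨_, _⟩ | ⟨_, _⟩ <;> simp_all)
    _ = _ := by
        rw [Finset.sum_add_distrib, Finset.sum_ite_eq', Finset.sum_ite_eq']
        simp

/-- A uniformly random ranking puts `b` directly below `a` with probability at most
`1 / (K - 1)`. -/
lemma sum_perm_adjacent_le {K : ℕ} (hK : 2 ≤ K) (a b : Fin K) :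
    ((K : ℝ) - 1) * ∑ σ : Equiv.Perm (Fin K), (if (σ b).1 + 1 = (σ a).1 then (1 : ℝ) else 0) ≤
      Fintype.card (Equiv.Perm (Fin K)) := by
  classical
  by_cases hab : b = a
  · subst hab
    simp
  have hsym : ∀ c, c ≠ a →
      ∑ σ : Equiv.Perm (Fin K), (if (σ c).1 + 1 = (σ a).1 then (1 : ℝ) else 0) =
      ∑ σ : Equiv.Perm (Fin K), (if (σ b).1 + 1 = (σ a).1 then (1 : ℝ) else 0) := by
    intro c hc
    refine Fintype.sum_equiv (Equiv.mulRight (Equiv.swap b c)) _ _ fun σ => ?_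
    simp [Equiv.swap_apply_of_ne_of_ne (Ne.symm hab) (Ne.symm hc)]
  have h1 : ((K : ℝ) - 1) *
      ∑ σ : Equiv.Perm (Fin K), (if (σ b).1 + 1 = (σ a).1 then (1 : ℝ) else 0) =
      ∑ c ∈ Finset.univ.erase a,
        ∑ σ : Equiv.Perm (Fin K), (if (σ c).1 + 1 = (σ a).1 then (1 : ℝ) else 0) := by
    rw [Finset.sum_congr rfl fun c hc => hsym c (Finset.ne_of_mem_erase hc), Finset.sum_const,
      Finset.card_erase_of_mem (Finset.mem_univ a), nsmul_eq_mul, Finset.card_univ,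
      Fintype.card_fin, Nat.cast_sub (by omega), Nat.cast_one]
  rw [h1, Finset.sum_comm]
  have h2 : ∀ σ : Equiv.Perm (Fin K),
      ∑ c ∈ Finset.univ.erase a, (if (σ c).1 + 1 = (σ a).1 then (1 : ℝ) else 0) ≤ 1 := by
    intro σ
    rw [Finset.sum_boole]
    have : (Finset.filter (fun c => (σ c).1 + 1 = (σ a).1) (Finset.univ.erase a)).card ≤ 1 := by
      refine Finset.card_le_one.2 fun x hx y hy => σ.injective (Fin.ext ?_)
      have hx' := (Finset.mem_filter.1 hx).2
      have hy' := (Finset.mem_filter.1 hy).2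
      omega
    exact_mod_cast this
  calc _ ≤ ∑ _σ : Equiv.Perm (Fin K), (1 : ℝ) := Finset.sum_le_sum fun σ _ => h2 σ
    _ = _ := by simp

lemma klBer_pos_s8 {p : ℝ} (hp : 0 < p) (hp' : p < 1 / 2) : 0 < klBer p := by
  refine mul_pos (by linarith) (Real.log_pos ?_)
  rw [lt_div_iff₀ hp]
  linarith

open Classical in
lemma naErrSORT_eq (K T : ℕ) (p : ℝ) (π : Fin T → Fin K × Fin K → ℝ)
    (out : (Fin T → Fin K × Fin K) → (Fin T → Bool) → Equiv.Perm (Fin K)) (θ : Fin K → ℝ) :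
    naErrSORT K T p π out θ = ∑ ks : Fin T → Fin K × Fin K, ∑ ys : Fin T → Bool,
      (∏ t, π t (ks t)) * flipLik p (fun t => answer θ (ks t)) ys *
        (if StrictMono (fun i => θ (out ks ys i)) then 0 else 1) := by
  unfold naErrSORT flipLik answer
  simp_rw [Finset.prod_mul_distrib]

lemma sum_weight_mul_flipLik {K T : ℕ} (p : ℝ) (π : Fin T → Fin K × Fin K → ℝ)
    (hπ1 : ∀ t, ∑ k, π t k = 1) (θ : Fin K → ℝ) :
    ∑ ks : Fin T → Fin K × Fin K, ∑ ys : Fin T → Bool,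
      (∏ t, π t (ks t)) * flipLik p (fun t => answer θ (ks t)) ys = 1 := by
  simp_rw [← Finset.mul_sum, sum_flipLik, mul_one]
  rw [sum_pi_prod]
  simp [hπ1]

lemma naErrSORT_nonneg {K T : ℕ} {p : ℝ} (hp : 0 < p) (hp' : p < 1 / 2)
    {π : Fin T → Fin K × Fin K → ℝ} (hπ : ∀ t k, 0 ≤ π t k)
    (out : (Fin T → Fin K × Fin K) → (Fin T → Bool) → Equiv.Perm (Fin K)) (θ : Fin K → ℝ) :
    0 ≤ naErrSORT K T p π out θ := by
  rw [naErrSORT_eq]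
  refine Finset.sum_nonneg fun ks _ => Finset.sum_nonneg fun ys _ => mul_nonneg
    (mul_nonneg (Finset.prod_nonneg fun t _ => hπ t _) (flipLik_pos hp hp' _ _).le) ?_
  split_ifs <;> norm_num

open Classical in
lemma one_sub_naErrSORT {K T : ℕ} (p : ℝ)
    {π : Fin T → Fin K × Fin K → ℝ} (hπ1 : ∀ t, ∑ k, π t k = 1)
    (out : (Fin T → Fin K × Fin K) → (Fin T → Bool) → Equiv.Perm (Fin K)) (θ : Fin K → ℝ) :
    1 - naErrSORT K T p π out θ = ∑ ks : Fin T → Fin K × Fin K, ∑ ys : Fin T → Bool,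
      (∏ t, π t (ks t)) * flipLik p (fun t => answer θ (ks t)) ys *
        (if StrictMono (fun i => θ (out ks ys i)) then 1 else 0) := by
  rw [naErrSORT_eq]
  refine sub_eq_iff_eq_add.2 ((sum_weight_mul_flipLik p π hπ1 θ).symm.trans ?_)
  simp_rw [← Finset.sum_add_distrib]
  refine Finset.sum_congr rfl fun ks _ => Finset.sum_congr rfl fun ys _ => ?_
  split_ifs <;> ring

lemma naErrSORT_le_one {K T : ℕ} {p : ℝ} (hp : 0 < p) (hp' : p < 1 / 2)
    {π : Fin T → Fin K × Fin K → ℝ} (hπ : ∀ t k, 0 ≤ π t k) (hπ1 : ∀ t, ∑ k, π t k = 1)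
    (out : (Fin T → Fin K × Fin K) → (Fin T → Bool) → Equiv.Perm (Fin K)) (θ : Fin K → ℝ) :
    naErrSORT K T p π out θ ≤ 1 := by
  rw [← sub_nonneg, one_sub_naErrSORT p hπ1]
  refine Finset.sum_nonneg fun ks _ => Finset.sum_nonneg fun ys _ => mul_nonneg
    (mul_nonneg (Finset.prod_nonneg fun t _ => hπ t _) (flipLik_pos hp hp' _ _).le) ?_
  split_ifs <;> norm_num

/-- Kullback–Leibler divergence between the transcripts of two instances. -/
lemma sum_weight_mul_flipLik_mul_log {K T : ℕ} {p : ℝ} (hp : 0 < p) (hp' : p < 1 / 2)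
    {π : Fin T → Fin K × Fin K → ℝ} (hπ1 : ∀ t, ∑ k, π t k = 1) (θ θ' : Fin K → ℝ) :
    ∑ ks : Fin T → Fin K × Fin K, ∑ ys : Fin T → Bool, (∏ t, π t (ks t)) *
      (flipLik p (fun t => answer θ (ks t)) ys *
        Real.log (flipLik p (fun t => answer θ (ks t)) ys /
          flipLik p (fun t => answer θ' (ks t)) ys)) =
    ∑ t, ∑ k, π t k * (klBer p * if answer θ k = answer θ' k then 0 else 1) := by
  simp_rw [← Finset.mul_sum, sum_flipLik_mul_log hp hp']
  rw [sum_pi_prod_mul_sum π (fun _ k => if answer θ k = answer θ' k then 0 else klBer p) hπ1]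
  simp

section LowerBound

variable {K T : ℕ} {p S : ℝ} {π : Fin T → Fin K × Fin K → ℝ} {Ω : Type} [Fintype Ω] {w : Ω → ℝ}
  {out : Ω → (Fin T → Fin K × Fin K) → (Fin T → Bool) → Equiv.Perm (Fin K)}

open Classical in
/-- Fano's inequality for a ranking and its adjacent transpositions. -/
lemma fano_adjacent_swaps (hK : 2 ≤ K) (hp : 0 < p) (hp' : p < 1 / 2)
    (hπ : ∀ t k, 0 ≤ π t k) (hπ1 : ∀ t, ∑ k, π t k = 1)
    (hw : ∀ ω, 0 ≤ w ω) (hw1 : ∑ ω, w ω = 1)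
    (hS : ∀ θ : Fin K → ℝ, Function.Injective θ →
      ∑ ω, w ω * naErrSORT K T p π (out ω) θ ≤ S) (σ : Equiv.Perm (Fin K)) :
    K * ((1 - S) * Real.log K - Real.log (2 - 1 / K)) ≤
      ∑ t, ∑ k, π t k * (klBer p * ∑ j, if answer (rankInstance (swapPred j * σ)) k =
        answer (rankInstance σ) k then 0 else 1) := by
  have : Nonempty (Fin K) := ⟨⟨0, by omega⟩⟩
  let W : Ω × (Fin T → Fin K × Fin K) × (Fin T → Bool) → ℝ :=
    fun z => w z.1 * ∏ t, π t (z.2.1 t)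
  let L : (Fin K → ℝ) → Ω × (Fin T → Fin K × Fin K) × (Fin T → Bool) → ℝ :=
    fun θ z => flipLik p (fun t => answer θ (z.2.1 t)) z.2.2
  have hWL : ∀ θ, ∑ z, W z * L θ z = 1 := by
    intro θ
    simp only [W, L, Fintype.sum_prod_type]
    refine (Finset.sum_congr rfl fun ω _ => ?_).trans hw1
    conv_rhs => rw [← mul_one (w ω), ← sum_weight_mul_flipLik p π hπ1 θ]
    simp only [Finset.mul_sum, mul_assoc]
  have hF := fano_inequality W
    (fun z => mul_nonneg (hw _) (Finset.prod_nonneg fun t _ => hπ t _))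
    (fun j : Fin K => L (rankInstance (swapPred j * σ))) (fun j z => flipLik_pos hp hp' _ _)
    (L (rankInstance σ)) (fun z => flipLik_pos hp hp' _ _) (hWL _) (fun j => hWL _)
    (fun j z => StrictMono fun i => rankInstance (swapPred j * σ) (out z.1 z.2.1 z.2.2 i))
    (fun z j j' h h' => swapPred_injective (mul_right_cancel
      ((eq_inv_of_strictMono_rankInstance h).trans (eq_inv_of_strictMono_rankInstance h').symm)))
  rw [Fintype.card_fin] at hF
  have hsucc : ∀ j : Fin K, 1 - S ≤ ∑ z, W z * L (rankInstance (swapPred j * σ)) z *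
      (if StrictMono fun i => rankInstance (swapPred j * σ) (out z.1 z.2.1 z.2.2 i)
        then 1 else 0) := by
    intro j
    have h1 := hS _ (rankInstance_injective (swapPred j * σ))
    have h2 : ∑ z, W z * L (rankInstance (swapPred j * σ)) z *
        (if StrictMono fun i => rankInstance (swapPred j * σ) (out z.1 z.2.1 z.2.2 i)
          then 1 else 0) =
        ∑ ω, w ω * (1 - naErrSORT K T p π (out ω) (rankInstance (swapPred j * σ))) := by
      simp only [W, L, Fintype.sum_prod_type]
      refine Finset.sum_congr rfl fun ω _ => ?_
      rw [one_sub_naErrSORT p hπ1]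
      simp only [Finset.mul_sum, mul_assoc]
    rw [h2]
    simp only [mul_sub, Finset.sum_sub_distrib, mul_one, hw1]
    linarith
  have hKL : ∀ j : Fin K, ∑ z, W z * (L (rankInstance (swapPred j * σ)) z *
      Real.log (L (rankInstance (swapPred j * σ)) z / L (rankInstance σ) z)) =
      ∑ t, ∑ k, π t k * (klBer p * if answer (rankInstance (swapPred j * σ)) k =
        answer (rankInstance σ) k then 0 else 1) := by
    intro j
    rw [← sum_weight_mul_flipLik_mul_log hp hp' hπ1]
    simp only [W, L, Fintype.sum_prod_type]
    rw [← one_mul (∑ ks : Fin T → Fin K × Fin K, _), ← hw1, Finset.sum_mul]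
    refine Finset.sum_congr rfl fun ω _ => ?_
    simp only [Finset.mul_sum, mul_assoc]
  simp_rw [hKL] at hF
  have hswap : ∑ j : Fin K, ∑ t, ∑ k, π t k * (klBer p *
      if answer (rankInstance (swapPred j * σ)) k = answer (rankInstance σ) k then 0 else 1) =
      ∑ t, ∑ k, π t k * (klBer p * ∑ j, if answer (rankInstance (swapPred j * σ)) k =
        answer (rankInstance σ) k then 0 else 1) := by
    rw [Finset.sum_comm]
    refine Finset.sum_congr rfl fun t _ => ?_
    rw [Finset.sum_comm]
    simp only [Finset.mul_sum]
  rw [hswap] at hF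
  have hlog : 0 ≤ Real.log (K : ℝ) := Real.log_natCast_nonneg K
  have hsum := Finset.sum_le_sum fun j (_ : j ∈ Finset.univ) => hsucc j
  rw [Finset.sum_const, Finset.card_univ, Fintype.card_fin, nsmul_eq_mul] at hsum
  have := mul_le_mul_of_nonneg_right hsum hlog
  linarith

lemma one_sub_mul_log_le (hK : 2 ≤ K) (hp : 0 < p) (hp' : p < 1 / 2)
    (hπ : ∀ t k, 0 ≤ π t k) (hπ1 : ∀ t, ∑ k, π t k = 1)
    (hw : ∀ ω, 0 ≤ w ω) (hw1 : ∑ ω, w ω = 1)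
    (hS : ∀ θ : Fin K → ℝ, Function.Injective θ →
      ∑ ω, w ω * naErrSORT K T p π (out ω) θ ≤ S) :
    (1 - S) * Real.log K ≤ 4 * T * klBer p / (K : ℝ) ^ 2 + Real.log (2 - 1 / K) := by
  have hK2 : (2 : ℝ) ≤ K := by exact_mod_cast hK
  have hD := klBer_pos_s8 hp hp'
  set N : ℝ := (Fintype.card (Equiv.Perm (Fin K)) : ℝ) with hN
  have hN0 : 0 < N := by rw [hN]; exact_mod_cast Fintype.card_pos
  set X := (1 - S) * Real.log K - Real.log (2 - 1 / K) with hX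
  have hcount : ∀ k : Fin K × Fin K, ∑ σ : Equiv.Perm (Fin K), ∑ j,
      (if answer (rankInstance (swapPred j * σ)) k = answer (rankInstance σ) k
        then (0 : ℝ) else 1) ≤ 2 * N / (K - 1) := by
    intro k
    refine (Finset.sum_le_sum fun σ _ => sum_answer_ne_le σ k).trans ?_
    rw [Finset.sum_add_distrib, le_div_iff₀ (by linarith)]
    have h1 := sum_perm_adjacent_le hK k.1 k.2
    have h2 := sum_perm_adjacent_le hK k.2 k.1
    linarith
  have hmain : N * (K * X) ≤ T * (klBer p * (2 * N / (K - 1))) := by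
    calc N * (K * X) = ∑ _σ : Equiv.Perm (Fin K), K * X := by simp [hN]
      _ ≤ ∑ σ : Equiv.Perm (Fin K), ∑ t, ∑ k, π t k * (klBer p * ∑ j,
          if answer (rankInstance (swapPred j * σ)) k =
            answer (rankInstance σ) k then 0 else 1) :=
        Finset.sum_le_sum fun σ _ => fano_adjacent_swaps hK hp hp' hπ hπ1 hw hw1 hS σ
      _ = ∑ t, ∑ k, π t k * (klBer p * ∑ σ : Equiv.Perm (Fin K), ∑ j,
          if answer (rankInstance (swapPred j * σ)) k =
            answer (rankInstance σ) k then 0 else 1) := by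
        rw [Finset.sum_comm]
        refine Finset.sum_congr rfl fun t _ => ?_
        rw [Finset.sum_comm]
        simp only [Finset.mul_sum]
      _ ≤ ∑ t, ∑ k, π t k * (klBer p * (2 * N / (K - 1))) := by
        refine Finset.sum_le_sum fun t _ => Finset.sum_le_sum fun k _ => ?_
        exact mul_le_mul_of_nonneg_left (mul_le_mul_of_nonneg_left (hcount k) hD.le) (hπ t k)
      _ = T * (klBer p * (2 * N / (K - 1))) := by
        simp_rw [← Finset.sum_mul, hπ1]
        simp
  have hK1 : (0 : ℝ) < K - 1 := by linarith
  have hdiv : K * X ≤ T * (klBer p * (2 / (K - 1))) := by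
    refine le_of_mul_le_mul_left (hmain.trans (le_of_eq ?_)) hN0
    ring
  have h2 : (2 : ℝ) / (K - 1) ≤ 4 / K := by
    rw [div_le_div_iff₀ hK1 (by linarith)]
    linarith
  have h3 : K * X ≤ T * (klBer p * (4 / K)) :=
    hdiv.trans (mul_le_mul_of_nonneg_left (mul_le_mul_of_nonneg_left h2 hD.le) (by positivity))
  have h4 : X ≤ 4 * T * klBer p / (K : ℝ) ^ 2 := by
    rw [le_div_iff₀ (by positivity)]
    have := mul_le_mul_of_nonneg_right h3 (by linarith : (0 : ℝ) ≤ K)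
    have h5 : T * (klBer p * (4 / K)) * (K : ℝ) = 4 * T * klBer p := by field_simp
    rw [h5] at this
    linarith
  linarith

end LowerBound

lemma log_two_sub_inv_le {K : ℕ} (hK : 2 ≤ K) :
    Real.log (2 - 1 / (K : ℝ)) ≤ (97 / 150) * Real.log K := by
  rcases hK.eq_or_lt with rfl | h
  · have h1 : Real.log (2 - 1 / ((2 : ℕ) : ℝ)) = Real.log 3 - Real.log 2 := by
      rw [← Real.log_div (by norm_num) (by norm_num)]
      norm_num
    have h2 : Real.log ((3 : ℝ) ^ 5) ≤ Real.log ((2 : ℝ) ^ 8) :=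
      Real.log_le_log (by norm_num) (by norm_num)
    rw [Real.log_pow, Real.log_pow] at h2
    have h3 := Real.log_pos (by norm_num : (1 : ℝ) < 2)
    rw [h1]
    push_cast at *
    linarith
  · have hK3 : (3 : ℝ) ≤ K := by exact_mod_cast h
    have h0 : 1 / (K : ℝ) ≤ 1 / 3 := one_div_le_one_div_of_le (by norm_num) hK3
    have hi : 0 < 1 / (K : ℝ) := by positivity
    have h1 : Real.log (2 - 1 / (K : ℝ)) ≤ Real.log 2 :=
      Real.log_le_log (by linarith) (by linarith)
    have h2 : Real.log ((2 : ℝ) ^ 11) ≤ Real.log ((3 : ℝ) ^ 7) :=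
      Real.log_le_log (by norm_num) (by norm_num)
    rw [Real.log_pow, Real.log_pow] at h2
    have h3 := Real.log_pos (by norm_num : (1 : ℝ) < 2)
    have h4 : Real.log 3 ≤ Real.log K := Real.log_le_log (by norm_num) hK3
    push_cast at *
    linarith

/-- Lower bound for non-adaptively sorting `K` items from noisy pairwise comparisons.
First part: any (possibly randomized, via a seed `ω` for the output rule)
non-adaptive `T`-round algorithm has worst-case error probability, over instances `θ`
with `K` distinct real values, at least
`(1/2)·(1 - (4T·D_KL(p‖1-p)/K² + ln 2)/ln K)`.  Second part: consequently there is a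
universal constant `c > 0` such that any such algorithm with worst-case error
probability at most `1/3` satisfies `T ≥ c·K²·ln(K)/D_KL(p‖1-p)`. -/
theorem sort_nonadaptive_lower_bound :
    (∀ (K T : ℕ), 2 ≤ K → ∀ p : ℝ, 0 < p → p < 1 / 2 →
      ∀ (π : Fin T → Fin K × Fin K → ℝ), (∀ t k, 0 ≤ π t k) → (∀ t, ∑ k, π t k = 1) →
      ∀ (Ω : Type) [Fintype Ω], ∀ (w : Ω → ℝ), (∀ ω, 0 ≤ w ω) → (∑ ω, w ω) = 1 →
      ∀ (out : Ω → (Fin T → Fin K × Fin K) → (Fin T → Bool) → Equiv.Perm (Fin K)),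
        (1 / 2 : ℝ) *
            (1 - (4 * (T : ℝ) * klBer p / (K : ℝ) ^ 2 + Real.log 2) /
              Real.log (K : ℝ)) ≤
          ⨆ θ : {f : Fin K → ℝ // Function.Injective f},
            ∑ ω, w ω * naErrSORT K T p π (out ω) θ.1) ∧
    ∃ c : ℝ, 0 < c ∧
      ∀ (K T : ℕ), 2 ≤ K → ∀ p : ℝ, 0 < p → p < 1 / 2 →
      ∀ (π : Fin T → Fin K × Fin K → ℝ), (∀ t k, 0 ≤ π t k) → (∀ t, ∑ k, π t k = 1) →
      ∀ (Ω : Type) [Fintype Ω], ∀ (w : Ω → ℝ), (∀ ω, 0 ≤ w ω) → (∑ ω, w ω) = 1 →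
      ∀ (out : Ω → (Fin T → Fin K × Fin K) → (Fin T → Bool) → Equiv.Perm (Fin K)),
        (∀ θ : Fin K → ℝ, Function.Injective θ →
          ∑ ω, w ω * naErrSORT K T p π (out ω) θ ≤ 1 / 3) →
        c * (K : ℝ) ^ 2 * Real.log (K : ℝ) / klBer p ≤ (T : ℝ) := by
  refine ⟨?_, 1 / 200, by norm_num, ?_⟩
  · intro K T hK p hp hp' π hπ hπ1 Ω _ w hw hw1 out
    have hK2 : (2 : ℝ) ≤ K := by exact_mod_cast hK
    have hlog : 0 < Real.log (K : ℝ) := Real.log_pos (by linarith)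
    have hbdd : BddAbove (Set.range fun θ : {f : Fin K → ℝ // Function.Injective f} =>
        ∑ ω, w ω * naErrSORT K T p π (out ω) θ.1) := by
      refine ⟨1, ?_⟩
      rintro _ ⟨θ, rfl⟩
      calc _ ≤ ∑ ω, w ω * 1 := Finset.sum_le_sum fun ω _ =>
            mul_le_mul_of_nonneg_left (naErrSORT_le_one hp hp' hπ hπ1 _ _) (hw ω)
        _ = 1 := by simpa using hw1
    set S := ⨆ θ : {f : Fin K → ℝ // Function.Injective f},
      ∑ ω, w ω * naErrSORT K T p π (out ω) θ.1 with hSdef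
    have hS0 : 0 ≤ S := Real.iSup_nonneg fun θ => Finset.sum_nonneg fun ω _ =>
      mul_nonneg (hw ω) (naErrSORT_nonneg hp hp' hπ _ _)
    have h := one_sub_mul_log_le hK hp hp' hπ hπ1 hw hw1 (out := out) (S := S)
      fun θ hθ => le_ciSup hbdd ⟨θ, hθ⟩
    have hi : 1 / (K : ℝ) ≤ 1 := by rw [div_le_one (by linarith)]; linarith
    have hi0 : 0 < 1 / (K : ℝ) := by positivity
    have h2 : Real.log (2 - 1 / (K : ℝ)) ≤ Real.log 2 :=
      Real.log_le_log (by linarith) (by linarith)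
    have h3 : 1 - S ≤ (4 * (T : ℝ) * klBer p / (K : ℝ) ^ 2 + Real.log 2) / Real.log K := by
      rw [le_div_iff₀ hlog]
      linarith
    linarith
  · intro K T hK p hp hp' π hπ hπ1 Ω _ w hw hw1 out hS
    have hD := klBer_pos_s8 hp hp'
    have hK2 : (2 : ℝ) ≤ K := by exact_mod_cast hK
    have h := one_sub_mul_log_le hK hp hp' hπ hπ1 hw hw1 hS
    have h2 := log_two_sub_inv_le hK
    have h3 : (1 / 50) * Real.log K ≤ 4 * T * klBer p / (K : ℝ) ^ 2 := by linarith
    rw [le_div_iff₀ (by positivity)] at h3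
    rw [div_le_iff₀ hD]
    linarith
end
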